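/- Let A be the adjacency matrix of a connected, non-complete, inhomogeneous, 6-regular and 2 net-regular strongly regular signed graph with parameters (n, 6, a, b, c) lying in the class C1 ∪ C4 ∪ C5. If A contains an unbalanced triangle of the first type, then (a, b) ≠ (-2, -1), (a, b) ≠ (-2, 0) and (a, b) ≠ (-2, 1). -/

import Mathlib

/-- In a signed graph with constant row sums in which `2 A²` is a combination of `1`, the all-ones
matrix, `A` and (with nonzero coefficient) the entrywise square of `A`, the matrix `A` commutes
with its entrywise square. -/
theorem sum_sq_mul_eq_sum_mul_sq {n : ℕ} (A : Matrix (Fin n) (Fin n) ℤ) (a b c r ρ : ℤ)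
    (hsymm : ∀ i j, A i j = A j i)
    (hnet : ∀ i, ∑ j, A i j = ρ)
    (hsq : ∀ i j, 2 * (A * A) i j = (if i = j then 2 * (r - c) else 0) + 2 * c
      + (a - b) * A i j + (a + b - 2 * c) * A i j ^ 2)
    (hne : a + b - 2 * c ≠ 0) (i j : Fin n) :
    ∑ k, A i k ^ 2 * A j k = ∑ k, A i k * A j k ^ 2 := by
  have hcol : ∀ i, ∑ k, A k i = ρ := fun i => by simp_rw [hsymm _ i, hnet i]
  have hcomm : ∑ k, A i k * (2 * (A * A) k j) = ∑ k, (2 * (A * A) i k) * A k j := by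
    have h : (A * (A * A)) i j = ((A * A) * A) i j := by rw [Matrix.mul_assoc]
    rw [Matrix.mul_apply, Matrix.mul_apply] at h
    simp only [mul_left_comm _ (2 : ℤ), mul_assoc (2 : ℤ), ← Finset.mul_sum, h]
  have hleft : ∑ k, A i k * (2 * (A * A) k j) = 2 * (r - c) * A i j + 2 * c * ρ
      + (a - b) * ∑ k, A i k * A k j + (a + b - 2 * c) * ∑ k, A i k * A j k ^ 2 := by
    rw [← hnet i]
    simp_rw [hsq, mul_add, Finset.sum_add_distrib, Finset.mul_sum]
    congr 1
    · congr 1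
      · congr 1
        · simp [mul_comm]
        · exact Finset.sum_congr rfl fun k _ => by ring
      · exact Finset.sum_congr rfl fun k _ => by ring
    · exact Finset.sum_congr rfl fun k _ => by rw [hsymm k j]; ring
  have hright : ∑ k, (2 * (A * A) i k) * A k j = 2 * (r - c) * A i j + 2 * c * ρ
      + (a - b) * ∑ k, A i k * A k j + (a + b - 2 * c) * ∑ k, A i k ^ 2 * A j k := by
    rw [← hcol j]
    simp_rw [hsq, add_mul, Finset.sum_add_distrib, Finset.mul_sum]
    congr 1
    · congr 1
      · congr 1
        · simp
      · exact Finset.sum_congr rfl fun k _ => by ring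
    · exact Finset.sum_congr rfl fun k _ => by rw [hsymm k j]; ring
  rw [hleft, hright] at hcomm
  exact (mul_left_cancel₀ hne (add_left_cancel hcomm)).symm

/-- The number of columns `k` in which rows `i` and `j` have entries `s` and `t`. -/
def pairCount {n : ℕ} (A : Matrix (Fin n) (Fin n) ℤ) (i j : Fin n) (s t : ℤ) : ℤ :=
  ∑ k, if A i k = s ∧ A j k = t then 1 else 0

theorem pairCount_nonneg {n : ℕ} (A : Matrix (Fin n) (Fin n) ℤ) (i j : Fin n) (s t : ℤ) :
    0 ≤ pairCount A i j s t :=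
  Finset.sum_nonneg fun k _ => by split_ifs <;> simp

theorem not_and_of_pairCount_eq_zero {n : ℕ} {A : Matrix (Fin n) (Fin n) ℤ} {i j : Fin n}
    {s t : ℤ} (h : pairCount A i j s t = 0) (k : Fin n) : ¬(A i k = s ∧ A j k = t) := by
  have h' := (Finset.sum_eq_zero_iff_of_nonneg
    (fun k _ => by split_ifs <;> simp)).1 h k (Finset.mem_univ k)
  simpa using h'

/-- The local structure at a positive edge `ij` with `(A²) i j = -2` in a signed graph with four
positive and two negative neighbours at each vertex: no common neighbour is joined to `i` and `j`
by two negative edges, and exactly one is joined to `i` negatively and to `j` positively. -/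
theorem pairCount_of_pos {n : ℕ} (A : Matrix (Fin n) (Fin n) ℤ)
    (hdiag : ∀ i, A i i = 0)
    (hent : ∀ i j, A i j = -1 ∨ A i j = 0 ∨ A i j = 1)
    (hposdeg : ∀ i, ∑ k, (if A i k = 1 then (1 : ℤ) else 0) = 4)
    (hnegdeg : ∀ i, ∑ k, (if A i k = -1 then (1 : ℤ) else 0) = 2)
    (i j : Fin n)
    (hcomm : ∑ k, A i k ^ 2 * A j k = ∑ k, A i k * A j k ^ 2)
    (hij : A i j = 1) (hwalk : ∑ k, A i k * A j k = -2) :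
    pairCount A i j (-1) (-1) = 0 ∧ pairCount A i j (-1) 1 = 1 := by
  have hbal : ∑ k, A i k * A j k = pairCount A i j 1 1 + pairCount A i j (-1) (-1)
      - pairCount A i j 1 (-1) - pairCount A i j (-1) 1 := by
    unfold pairCount
    rw [← Finset.sum_add_distrib, ← Finset.sum_sub_distrib, ← Finset.sum_sub_distrib]
    refine Finset.sum_congr rfl fun k _ => ?_
    rcases hent i k with h | h | h <;> rcases hent j k with h' | h' | h' <;> simp [h, h']
  have hmixed : ∑ k, A i k ^ 2 * A j k - ∑ k, A i k * A j k ^ 2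
      = 2 * pairCount A i j (-1) 1 - 2 * pairCount A i j 1 (-1) := by
    unfold pairCount
    rw [Finset.mul_sum, Finset.mul_sum, ← Finset.sum_sub_distrib, ← Finset.sum_sub_distrib]
    refine Finset.sum_congr rfl fun k _ => ?_
    rcases hent i k with h | h | h <;> rcases hent j k with h' | h' | h' <;> simp [h, h']
  have hneg : pairCount A i j (-1) (-1) + pairCount A i j (-1) 1 ≤ 2 := by
    unfold pairCount
    rw [← hnegdeg i, ← Finset.sum_add_distrib]
    refine Finset.sum_le_sum fun k _ => ?_
    rcases hent i k with h | h | h <;> rcases hent j k with h' | h' | h' <;> simp [h, h']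
  have hpos : pairCount A i j 1 1 + pairCount A i j 1 (-1) + 1 ≤ 4 := by
    have hj : ∑ k, (if k = j then (1 : ℤ) else 0) = 1 := by simp
    unfold pairCount
    rw [← hposdeg i, ← hj, ← Finset.sum_add_distrib, ← Finset.sum_add_distrib]
    refine Finset.sum_le_sum fun k _ => ?_
    by_cases hk : k = j
    · subst hk
      simp [hij, hdiag]
    · rcases hent i k with h | h | h <;> rcases hent j k with h' | h' | h' <;> simp [h, h', hk]
  have h1 := pairCount_nonneg A i j 1 1
  have h2 := pairCount_nonneg A i j (-1) (-1)
  omega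

/-- If every vertex has four positive and two negative neighbours, `A` commutes with its entrywise
square, and `A²` is `-2` on positive and `b` on negative edges, then `b ≥ 2`. -/
theorem two_le_of_pos_eq_neg_two {n : ℕ} (A : Matrix (Fin n) (Fin n) ℤ) (b : ℤ)
    (hsymm : ∀ i j, A i j = A j i)
    (hdiag : ∀ i, A i i = 0)
    (hent : ∀ i j, A i j = -1 ∨ A i j = 0 ∨ A i j = 1)
    (hposdeg : ∀ i, ∑ k, (if A i k = 1 then (1 : ℤ) else 0) = 4)
    (hnegdeg : ∀ i, ∑ k, (if A i k = -1 then (1 : ℤ) else 0) = 2)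
    (hcomm : ∀ i j, ∑ k, A i k ^ 2 * A j k = ∑ k, A i k * A j k ^ 2)
    (hpos : ∀ i j, A i j = 1 → ∑ k, A i k * A j k = -2)
    (hneg : ∀ i j, A i j = -1 → ∑ k, A i k * A j k = b) (i : Fin n) : 2 ≤ b := by
  have hloc : ∀ i j, A i j = 1 →
      pairCount A i j (-1) (-1) = 0 ∧ pairCount A i j (-1) 1 = 1 := fun i j hij =>
    pairCount_of_pos A hdiag hent hposdeg hnegdeg i j (hcomm i j) hij (hpos i j hij)
  have hno : ∀ i j k, A i j = 1 → ¬(A i k = -1 ∧ A j k = -1) := fun i j k hij =>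
    not_and_of_pairCount_eq_zero (hloc i j hij).1 k
  have hle : ∀ k, A i k = -1 → pairCount A i k 1 1 ≤ b := by
    intro k hik
    rw [← hneg i k hik]
    refine Finset.sum_le_sum fun j _ => ?_
    have h1 := hno i j k
    have h2 := hno k j i
    rw [hsymm j k] at h1
    rw [hsymm k i, hsymm j i] at h2
    rcases hent i j with h | h | h <;> rcases hent k j with h' | h' | h' <;> simp_all
  have hcount : ∑ j, (if A i j = 1 then pairCount A i j (-1) 1 else 0)
      = ∑ k, (if A i k = -1 then pairCount A i k 1 1 else 0) := by
    have hite : ∀ (p : Prop) [Decidable p] (f : Fin n → ℤ),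
        (if p then ∑ k, f k else 0) = ∑ k, if p then f k else 0 := fun p _ f => by
      split_ifs <;> simp
    simp only [pairCount, hite]
    rw [Finset.sum_comm]
    refine Finset.sum_congr rfl fun k _ => Finset.sum_congr rfl fun j _ => ?_
    rw [hsymm k j]
    simp only [← ite_and]
    congr 1
    exact propext (by tauto)
  have hfour : ∑ j, (if A i j = 1 then pairCount A i j (-1) 1 else 0) = 4 := by
    rw [← hposdeg i]
    refine Finset.sum_congr rfl fun j _ => ?_
    split_ifs with h
    · exact (hloc i j h).2
    · rfl
  have htwo : ∑ k, (if A i k = -1 then pairCount A i k 1 1 else 0) ≤ 2 * b := by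
    rw [← hnegdeg i, Finset.sum_mul]
    refine Finset.sum_le_sum fun k _ => ?_
    split_ifs with h
    · simpa using hle k h
    · simp
  omega


theorem stmt9 {n : ℕ} (A : Matrix (Fin n) (Fin n) ℤ) (a b c : ℤ)
    (hsymm : ∀ i j, A i j = A j i)
    (hdiag : ∀ i, A i i = 0)
    (hent : ∀ i j, A i j = -1 ∨ A i j = 0 ∨ A i j = 1)
    (hconn : (SimpleGraph.fromRel (fun i j => A i j ≠ 0)).Connected)
    (hncomp : ¬ ∀ i j : Fin n, i ≠ j → A i j ≠ 0)
    (hinhom : (∃ i j, A i j = 1) ∧ (∃ i j, A i j = -1))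
    (hreg : ∀ i, (Finset.univ.filter (fun j => A i j ≠ 0)).card = 6)
    (hnet : ∀ i, ∑ j, A i j = 2)
    (hAA : ∀ i, (A * A) i i = 6)
    (hpos : ∀ i j, A i j = 1 → (A * A) i j = a)
    (hneg : ∀ i j, A i j = -1 → (A * A) i j = b)
    (hnon : ∀ i j, i ≠ j → A i j = 0 → (A * A) i j = c)
    (hclass : ¬(a = -b ∧ c = 0) ∧ ¬(a ≠ -b ∧ 2 * c = a + b))
    (htri1 : ∃ i j k : Fin n,
      (A i j = -1 ∧ A j k = 1 ∧ A i k = 1) ∨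
      (A i j = 1 ∧ A j k = -1 ∧ A i k = 1) ∨
      (A i j = 1 ∧ A j k = 1 ∧ A i k = -1)) :
    ¬(a = -2 ∧ b = -1) ∧ ¬(a = -2 ∧ b = 0) ∧ ¬(a = -2 ∧ b = 1) := by
  obtain ⟨i₀, -⟩ := hinhom.1
  have hmul : ∀ i j, (A * A) i j = ∑ k, A i k * A j k := fun i j => by
    simp_rw [Matrix.mul_apply, hsymm _ j]
  have hdeg : ∀ i, ∑ k, A i k ^ 2 = 6 := fun i => by
    rw [← hAA i, hmul]
    exact Finset.sum_congr rfl fun k _ => sq _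
  have hposdeg : ∀ i, ∑ k, (if A i k = 1 then (1 : ℤ) else 0) = 4 := by
    intro i
    have h : 2 * ∑ k, (if A i k = 1 then (1 : ℤ) else 0) = ∑ k, A i k ^ 2 + ∑ k, A i k := by
      rw [Finset.mul_sum, ← Finset.sum_add_distrib]
      refine Finset.sum_congr rfl fun k _ => ?_
      rcases hent i k with h | h | h <;> simp [h]
    linarith [hdeg i, hnet i]
  have hnegdeg : ∀ i, ∑ k, (if A i k = -1 then (1 : ℤ) else 0) = 2 := by
    intro i
    have h : 2 * ∑ k, (if A i k = -1 then (1 : ℤ) else 0) = ∑ k, A i k ^ 2 - ∑ k, A i k := by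
      rw [Finset.mul_sum, ← Finset.sum_sub_distrib]
      refine Finset.sum_congr rfl fun k _ => ?_
      rcases hent i k with h | h | h <;> simp [h]
    linarith [hdeg i, hnet i]
  have hsq : ∀ i j, 2 * (A * A) i j = (if i = j then 2 * (6 - c) else 0) + 2 * c
      + (a - b) * A i j + (a + b - 2 * c) * A i j ^ 2 := by
    intro i j
    by_cases hij : i = j
    · subst hij
      rw [hAA, hdiag, if_pos rfl]
      ring
    · rw [if_neg hij]
      rcases hent i j with h | h | h
      · rw [hneg i j h, h]
        ring
      · rw [hnon i j hij h, h]
        ring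
      · rw [hpos i j h, h]
        ring
  have key : a = -2 → b < 2 → a + b = 2 * c := by
    intro ha hb
    by_contra hne
    have hcomm := sum_sq_mul_eq_sum_mul_sq A a b c 6 2 hsymm hnet hsq (by omega)
    refine absurd (two_le_of_pos_eq_neg_two A b hsymm hdiag hent hposdeg hnegdeg hcomm
      (fun i j h => ?_) (fun i j h => ?_) i₀) (by omega)
    · rw [← hmul, hpos i j h, ha]
    · rw [← hmul, hneg i j h]
  refine ⟨?_, ?_, ?_⟩ <;> rintro ⟨ha, hb⟩ <;>
    exact hclass.2 ⟨by omega, (key ha (by omega)).symm⟩
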